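/- Consider the flat CR chains pair with F¹(t,z¹,z²,p¹,p²) = (1 + (p¹)²)²/Δ and F²(t,z¹,z²,p¹,p²) = (1 + (p¹)²)(p²p¹ − z¹p¹ − t)/Δ, where Δ = p¹t + p² − z¹, defined on the open set where Δ ≠ 0. Then the Fels torsion of this pair of second order ODEs vanishes identically: T^i_j = 0 for all i, j ∈ {1,2} at every point of the domain. -/

import Mathlib

noncomputable section

/-- Partial derivative of a function on `ℝⁿ` in the `i`-th coordinate direction. -/
def pdn {n : ℕ} (i : Fin n) (f : (Fin n → ℝ) → ℝ) (q : Fin n → ℝ) : ℝ :=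
  deriv (fun t => f (Function.update q i t)) (q i)

/-- Coordinates on `ℝ⁵` are `(t, z¹, z², p¹, p²)`: index of `zⁱ`. -/
def zIdx : Fin 2 → Fin 5 := ![1, 2]

/-- Index of `pⁱ` among the coordinates `(t, z¹, z², p¹, p²)`. -/
def pIdx : Fin 2 → Fin 5 := ![3, 4]

/-- The total derivative vector field of the pair of second order ODEs
`(zⁱ)'' = Fⁱ(t, z¹, z², p¹, p²)`, applied to a function `f`:
`D f = ∂_t f + p¹∂_{z¹} f + p²∂_{z²} f + F¹∂_{p¹} f + F²∂_{p²} f`. -/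
def totalDeriv (F : Fin 2 → (Fin 5 → ℝ) → ℝ) (f : (Fin 5 → ℝ) → ℝ)
    (q : Fin 5 → ℝ) : ℝ :=
  pdn 0 f q + q 3 * pdn 1 f q + q 4 * pdn 2 f q
    + F 0 q * pdn 3 f q + F 1 q * pdn 4 f q

/-- `Fⁱⱼ = −∂Fⁱ/∂zʲ + (1/2)·D(∂Fⁱ/∂pʲ) − (1/4)·Σₖ (∂Fⁱ/∂pᵏ)(∂Fᵏ/∂pʲ)`. -/
def felsF (F : Fin 2 → (Fin 5 → ℝ) → ℝ) (i j : Fin 2) (q : Fin 5 → ℝ) : ℝ :=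
  -(pdn (zIdx j) (F i) q)
    + (1/2) * totalDeriv F (fun r => pdn (pIdx j) (F i) r) q
    - (1/4) * ∑ k : Fin 2, pdn (pIdx k) (F i) q * pdn (pIdx j) (F k) q

/-- The Fels torsion `Tⁱⱼ = Fⁱⱼ − (1/2)δⁱⱼ(F¹₁ + F²₂)` of a pair of second order ODEs. -/
def felsT (F : Fin 2 → (Fin 5 → ℝ) → ℝ) (i j : Fin 2) (q : Fin 5 → ℝ) : ℝ :=
  felsF F i j q
    - (1/2) * (if i = j then (1 : ℝ) else 0) * (felsF F 0 0 q + felsF F 1 1 q)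

section PartialDerivatives

variable {n : ℕ} {i : Fin n} {f g : (Fin n → ℝ) → ℝ} {q : Fin n → ℝ}

lemma hasDerivAt_comp_update (hf : DifferentiableAt ℝ f q) :
    HasDerivAt (fun t => f (Function.update q i t)) (pdn i f q) (q i) := by
  have h : DifferentiableAt ℝ (fun t => f (Function.update q i t)) (q i) := by
    refine DifferentiableAt.comp (g := f) (q i) ?_
      (hasDerivAt_update q i (q i)).differentiableAt
    simpa using hf
  exact h.hasDerivAt

lemma pdn_congr (h : f =ᶠ[nhds q] g) : pdn i f q = pdn i g q := by
  have hc : Filter.Tendsto (fun t => Function.update q i t) (nhds (q i)) (nhds q) := by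
    have := (hasDerivAt_update q i (q i)).continuousAt.tendsto
    simpa using this
  exact Filter.EventuallyEq.deriv_eq (hc.eventually h)

lemma pdn_const (c : ℝ) : pdn i (fun _ => c) q = 0 := by
  simp [pdn]

lemma pdn_coord (j : Fin n) : pdn i (fun r => r j) q = if j = i then 1 else 0 := by
  by_cases h : j = i
  · subst h
    simp [pdn]
  · simp [pdn, h]

lemma pdn_neg (hf : DifferentiableAt ℝ f q) :
    pdn i (fun r => -f r) q = -pdn i f q :=
  (hasDerivAt_comp_update hf).neg.deriv

lemma pdn_add (hf : DifferentiableAt ℝ f q) (hg : DifferentiableAt ℝ g q) :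
    pdn i (fun r => f r + g r) q = pdn i f q + pdn i g q :=
  ((hasDerivAt_comp_update hf).add (hasDerivAt_comp_update hg)).deriv

lemma pdn_sub (hf : DifferentiableAt ℝ f q) (hg : DifferentiableAt ℝ g q) :
    pdn i (fun r => f r - g r) q = pdn i f q - pdn i g q :=
  ((hasDerivAt_comp_update hf).sub (hasDerivAt_comp_update hg)).deriv

lemma pdn_mul (hf : DifferentiableAt ℝ f q) (hg : DifferentiableAt ℝ g q) :
    pdn i (fun r => f r * g r) q = pdn i f q * g q + f q * pdn i g q := by
  refine ((hasDerivAt_comp_update (i := i) hf).mul (hasDerivAt_comp_update hg)).deriv.trans ?_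
  simp

lemma pdn_pow (hf : DifferentiableAt ℝ f q) (m : ℕ) :
    pdn i (fun r => f r ^ m) q = m * f q ^ (m - 1) * pdn i f q := by
  refine ((hasDerivAt_comp_update (i := i) hf).pow m).deriv.trans ?_
  simp

lemma pdn_div (hf : DifferentiableAt ℝ f q) (hg : DifferentiableAt ℝ g q) (h : g q ≠ 0) :
    pdn i (fun r => f r / g r) q = (pdn i f q * g q - f q * pdn i g q) / g q ^ 2 := by
  refine ((hasDerivAt_comp_update (i := i) hf).div (hasDerivAt_comp_update hg)
    (by simpa using h)).deriv.trans ?_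
  simp

end PartialDerivatives

/-- The right-hand sides of the flat CR chains pair. -/
abbrev flatChains : Fin 2 → (Fin 5 → ℝ) → ℝ :=
  ![fun r => (1 + (r 3) ^ 2) ^ 2 / (r 3 * r 0 + r 4 - r 1),
    fun r => (1 + (r 3) ^ 2) * (r 4 * r 3 - r 1 * r 3 - r 0) / (r 3 * r 0 + r 4 - r 1)]

/-- The Jacobian `∂Fⁱ/∂pʲ` of the flat CR chains pair. -/
abbrev flatChainsJac : Fin 2 → Fin 2 → (Fin 5 → ℝ) → ℝ :=
  ![![fun r => (4 * r 3 * (1 + r 3 ^ 2) * (r 3 * r 0 + r 4 - r 1) - (1 + r 3 ^ 2) ^ 2 * r 0)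
        / (r 3 * r 0 + r 4 - r 1) ^ 2,
      fun r => -(1 + r 3 ^ 2) ^ 2 / (r 3 * r 0 + r 4 - r 1) ^ 2],
    ![fun r => ((2 * r 3 * (r 4 * r 3 - r 1 * r 3 - r 0) + (1 + r 3 ^ 2) * (r 4 - r 1))
          * (r 3 * r 0 + r 4 - r 1) - (1 + r 3 ^ 2) * (r 4 * r 3 - r 1 * r 3 - r 0) * r 0)
        / (r 3 * r 0 + r 4 - r 1) ^ 2,
      fun r => (1 + r 3 ^ 2) ^ 2 * r 0 / (r 3 * r 0 + r 4 - r 1) ^ 2]]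

lemma pdn_pIdx_flatChains (i j : Fin 2) {q : Fin 5 → ℝ} (h : q 3 * q 0 + q 4 - q 1 ≠ 0) :
    pdn (pIdx j) (flatChains i) q = flatChainsJac i j q := by
  fin_cases i <;> fin_cases j <;>
    simp (disch := first | assumption | fun_prop) [pIdx, pdn_div, pdn_mul, pdn_sub, pdn_add,
      pdn_pow, pdn_coord, pdn_const] <;>
    field_simp <;> ring

lemma pdn_pdn_pIdx_flatChains (i j : Fin 2) (k : Fin 5) {q : Fin 5 → ℝ}
    (h : q 3 * q 0 + q 4 - q 1 ≠ 0) :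
    pdn k (fun r => pdn (pIdx j) (flatChains i) r) q = pdn k (flatChainsJac i j) q := by
  have hc : ContinuousAt (fun r : Fin 5 → ℝ => r 3 * r 0 + r 4 - r 1) q := by fun_prop
  exact pdn_congr ((hc.eventually_ne h).mono fun r hr => pdn_pIdx_flatChains i j hr)

/-- For the flat CR chains pair, the matrix `Fⁱⱼ` is a multiple of the identity. -/
lemma felsF_flatChains (i j : Fin 2) {q : Fin 5 → ℝ} (h : q 3 * q 0 + q 4 - q 1 ≠ 0) :
    felsF flatChains i j q = if i = j then felsF flatChains 0 0 q else 0 := by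
  have h2 : (q 3 * q 0 + q 4 - q 1) ^ 2 ≠ 0 := pow_ne_zero 2 h
  simp only [felsF, totalDeriv, pdn_pdn_pIdx_flatChains _ _ _ h, pdn_pIdx_flatChains _ _ h,
    Fin.sum_univ_two]
  fin_cases i <;> fin_cases j <;>
    simp (disch := first | assumption | fun_prop (disch := assumption)) [zIdx, pdn_div, pdn_mul,
      pdn_neg, pdn_sub, pdn_add, pdn_pow, pdn_coord, pdn_const] <;>
    field_simp <;> ring

/-- the Fels torsion of the flat CR chains pair
`(z¹)'' = (1 + (p¹)²)²/Δ`, `(z²)'' = (1 + (p¹)²)(p²p¹ − z¹p¹ − t)/Δ`, with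
`Δ = p¹t + p² − z¹`, vanishes identically on the open set `Δ ≠ 0`. -/
theorem flat_CR_chains_pair_torsion_free :
    ∀ q : Fin 5 → ℝ, q 3 * q 0 + q 4 - q 1 ≠ 0 → ∀ i j : Fin 2,
      felsT
        ![fun r => (1 + (r 3) ^ 2) ^ 2 / (r 3 * r 0 + r 4 - r 1),
          fun r => (1 + (r 3) ^ 2) * (r 4 * r 3 - r 1 * r 3 - r 0)
            / (r 3 * r 0 + r 4 - r 1)] i j q = 0 := by
  intro q h i j
  change felsT flatChains i j q = 0
  rw [felsT, felsF_flatChains i j h, felsF_flatChains 1 1 h]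
  by_cases hij : i = j
  · simp only [hij, if_true]
    ring
  · simp [hij]
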